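/- Let (X_t)_{t∈ℕ} be a 1-approximating functional with constants (a_k)_{k≥0} of a stationary absolutely regular time series with mixing coefficients (β_k)_{k≥0}, with E X_0 = 0, and suppose for a fixed integer d ≥ 0 either (i) X_0 is a.s. bounded and Σ_{k=d}^∞ (a_k + β_k) < ∞, or (ii) E|X_0|^{2+δ} < ∞ for some δ > 0 and Σ_{k=d}^∞ (a_k^{δ/(1+δ)} + β_k^{δ/(2+δ)}) < ∞. Then, with S_n = X_1 + … + X_n, the series Σ_{k=1}^∞ E(X_0 X_k) converges absolutely and (1/n) E S_n² → E X_0² + 2 Σ_{k=1}^∞ E(X_0 X_k) as n → ∞. -/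

import Mathlib

open MeasureTheory ProbabilityTheory Filter

noncomputable section

/-- The σ-algebra 𝒜ₖˡ = σ(Z_k, …, Z_l). -/
def sigmaIcc {Ω : Type*} [MeasurableSpace Ω] (Z : ℤ → Ω → ℝ) (k l : ℤ) : MeasurableSpace Ω :=
  ⨆ i ∈ Set.Icc k l, MeasurableSpace.comap (Z i) inferInstance

/-- The σ-algebra 𝒜ₖ^∞ = σ(Z_k, Z_{k+1}, …). -/
def sigmaIci {Ω : Type*} [MeasurableSpace Ω] (Z : ℤ → Ω → ℝ) (k : ℤ) : MeasurableSpace Ω :=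
  ⨆ i ∈ Set.Ici k, MeasurableSpace.comap (Z i) inferInstance

/-- A stationary time series. -/
def Stationary {Ω : Type*} [MeasurableSpace Ω] (μ : Measure Ω) (Z : ℤ → Ω → ℝ) : Prop :=
  ∀ t : ℤ, Measure.map (fun ω => fun s : ℤ => Z (s + t) ω) μ
    = Measure.map (fun ω => fun s : ℤ => Z s ω) μ

/-- The absolute-regularity coefficient of two σ-algebras:
`sup Σ_i Σ_j |P(A_i ∩ B_j) − P(A_i)P(B_j)|` over all finite measurable partitions. -/
def betaCoeff {Ω : Type*} [MeasurableSpace Ω] (μ : Measure Ω)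
    (m₁ m₂ : MeasurableSpace Ω) : ℝ :=
  sSup {r : ℝ | ∃ (I J : ℕ) (A : Fin I → Set Ω) (B : Fin J → Set Ω),
    (∀ i, MeasurableSet[m₁] (A i)) ∧ (∀ j, MeasurableSet[m₂] (B j)) ∧
    Pairwise (Function.onFun Disjoint A) ∧ Pairwise (Function.onFun Disjoint B) ∧
    (⋃ i, A i) = Set.univ ∧ (⋃ j, B j) = Set.univ ∧
    r = ∑ i, ∑ j, |(μ (A i ∩ B j)).toReal - (μ (A i)).toReal * (μ (B j)).toReal|}

/-- The mixing coefficient `β_k = sup_n β(σ(Z_1,…,Z_n), σ(Z_{n+k},…))`. -/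
def betaMix {Ω : Type*} [MeasurableSpace Ω] (μ : Measure Ω) (Z : ℤ → Ω → ℝ) (k : ℕ) : ℝ :=
  sSup {r : ℝ | ∃ n : ℕ, 1 ≤ n ∧ r = betaCoeff μ (sigmaIcc Z 1 n) (sigmaIci Z (n + k))}


lemma beta_sum_le_two {Ω : Type*} (m₁ m₂ : MeasurableSpace Ω) [mΩ : MeasurableSpace Ω]
    (μ : Measure Ω) [IsProbabilityMeasure μ] (h₁ : m₁ ≤ mΩ) (h₂ : m₂ ≤ mΩ)
    (I J : ℕ) (A : Fin I → Set Ω) (B : Fin J → Set Ω)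
    (hA : ∀ i, MeasurableSet[m₁] (A i)) (hB : ∀ j, MeasurableSet[m₂] (B j))
    (dA : Pairwise (Function.onFun Disjoint A)) (dB : Pairwise (Function.onFun Disjoint B))
    (uA : (⋃ i, A i) = Set.univ) (uB : (⋃ j, B j) = Set.univ) :
    ∑ i, ∑ j, |(μ (A i ∩ B j)).toReal - (μ (A i)).toReal * (μ (B j)).toReal| ≤ 2 := by
  have sA : ∑ i, (μ (A i)).toReal = 1 := by
    have := measureReal_iUnion_fintype (μ := μ) dA (fun i => h₁ _ (hA i))
    rw [uA] at this
    simpa [Measure.real] using this.symm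
  have sB : ∑ i, (μ (B i)).toReal = 1 := by
    have := measureReal_iUnion_fintype (μ := μ) dB (fun i => h₂ _ (hB i))
    rw [uB] at this
    simpa [Measure.real] using this.symm
  have sAB : ∀ i, ∑ j, (μ (A i ∩ B j)).toReal = (μ (A i)).toReal := by
    intro i
    have := measureReal_iUnion_fintype (μ := μ) (f := fun j => A i ∩ B j)
      (fun j k hjk => (dB hjk).mono Set.inter_subset_right Set.inter_subset_right)
      (fun j => (h₁ _ (hA i)).inter (h₂ _ (hB j)))
    rw [← Set.inter_iUnion, uB, Set.inter_univ] at this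
    exact this.symm
  calc _ ≤ ∑ i, ∑ j, ((μ (A i ∩ B j)).toReal + (μ (A i)).toReal * (μ (B j)).toReal) := by
        gcongr with i _ j _
        refine (abs_sub _ _).trans (le_of_eq ?_)
        rw [abs_of_nonneg ENNReal.toReal_nonneg, abs_of_nonneg (by positivity)]
    _ = 2 := by
        simp only [Finset.sum_add_distrib, ← Finset.mul_sum, sB, sAB, sA]
        norm_num [sA]

lemma betaCoeff_bdd {Ω : Type*} (m₁ m₂ : MeasurableSpace Ω) [mΩ : MeasurableSpace Ω]
    (μ : Measure Ω) [IsProbabilityMeasure μ] (h₁ : m₁ ≤ mΩ) (h₂ : m₂ ≤ mΩ) :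
    (2 : ℝ) ∈ upperBounds {r : ℝ | ∃ (I J : ℕ) (A : Fin I → Set Ω) (B : Fin J → Set Ω),
    (∀ i, MeasurableSet[m₁] (A i)) ∧ (∀ j, MeasurableSet[m₂] (B j)) ∧
    Pairwise (Function.onFun Disjoint A) ∧ Pairwise (Function.onFun Disjoint B) ∧
    (⋃ i, A i) = Set.univ ∧ (⋃ j, B j) = Set.univ ∧
    r = ∑ i, ∑ j, |(μ (A i ∩ B j)).toReal - (μ (A i)).toReal * (μ (B j)).toReal|} := by
  rintro r ⟨I, J, A, B, hA, hB, dA, dB, uA, uB, rfl⟩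
  exact beta_sum_le_two m₁ m₂ μ h₁ h₂ I J A B hA hB dA dB uA uB

lemma betaCoeff_nonneg {Ω : Type*} (m₁ m₂ : MeasurableSpace Ω) [MeasurableSpace Ω]
    (μ : Measure Ω) : 0 ≤ betaCoeff μ m₁ m₂ := by
  apply Real.sSup_nonneg
  rintro r ⟨I, J, A, B, hA, hB, dA, dB, uA, uB, rfl⟩
  positivity

lemma betaMix_nonneg {Ω : Type*} [MeasurableSpace Ω] (μ : Measure Ω) (Z : ℤ → Ω → ℝ) (k : ℕ) :
    0 ≤ betaMix μ Z k := by
  apply Real.sSup_nonneg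
  rintro r ⟨n, _, rfl⟩
  exact betaCoeff_nonneg _ _ _

lemma sigmaIcc_le {Ω : Type*} [mΩ : MeasurableSpace Ω] (Z : ℤ → Ω → ℝ) (hZ : ∀ t, Measurable (Z t))
    (k l : ℤ) : sigmaIcc Z k l ≤ mΩ :=
  iSup₂_le fun i _ => (hZ i).comap_le

lemma sigmaIci_le {Ω : Type*} [mΩ : MeasurableSpace Ω] (Z : ℤ → Ω → ℝ) (hZ : ∀ t, Measurable (Z t))
    (k : ℤ) : sigmaIci Z k ≤ mΩ :=
  iSup₂_le fun i _ => (hZ i).comap_le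

lemma betaCoeff_le_betaMix {Ω : Type*} [MeasurableSpace Ω] (μ : Measure Ω)
    [IsProbabilityMeasure μ] (Z : ℤ → Ω → ℝ) (hZ : ∀ t, Measurable (Z t)) (n k : ℕ) (hn : 1 ≤ n) :
    betaCoeff μ (sigmaIcc Z 1 n) (sigmaIci Z (n + k)) ≤ betaMix μ Z k := by
  apply le_csSup
  · refine ⟨2, ?_⟩
    rintro r ⟨n, _, rfl⟩
    exact Real.sSup_le (betaCoeff_bdd _ _ μ (sigmaIcc_le Z hZ _ _) (sigmaIci_le Z hZ _))
      (by norm_num)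
  · exact ⟨n, hn, rfl⟩

lemma cov_partition {Ω : Type*} (m₁ m₂ : MeasurableSpace Ω) [mΩ : MeasurableSpace Ω]
    (μ : Measure Ω) [IsProbabilityMeasure μ] (h₁ : m₁ ≤ mΩ) (h₂ : m₂ ≤ mΩ)
    (I J : ℕ) (A : Fin I → Set Ω) (B : Fin J → Set Ω)
    (hA : ∀ i, MeasurableSet[m₁] (A i)) (hB : ∀ j, MeasurableSet[m₂] (B j))
    (dA : Pairwise (Function.onFun Disjoint A)) (dB : Pairwise (Function.onFun Disjoint B))
    (uA : (⋃ i, A i) = Set.univ) (uB : (⋃ j, B j) = Set.univ)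
    (u : Fin I → ℝ) (v : Fin J → ℝ) (T : ℝ) (hT : 0 ≤ T) (hu : ∀ i, |u i| ≤ T)
    (hv : ∀ i, |v i| ≤ T) (U V : Ω → ℝ)
    (hU : ∀ ω, U ω = ∑ i, (A i).indicator (fun _ => u i) ω)
    (hV : ∀ ω, V ω = ∑ i, (B i).indicator (fun _ => v i) ω) :
    |∫ ω, U ω * V ω ∂μ - (∫ ω, U ω ∂μ) * ∫ ω, V ω ∂μ| ≤ T ^ 2 * betaCoeff μ m₁ m₂ := by
  have eU : ∫ ω, U ω ∂μ = ∑ i, u i * (μ (A i)).toReal := by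
    simp_rw [hU]
    rw [integral_finsetSum _ fun i _ => (integrable_const (u i)).indicator (h₁ _ (hA i))]
    refine Finset.sum_congr rfl fun i _ => ?_
    rw [integral_indicator_const _ (h₁ _ (hA i)), smul_eq_mul, mul_comm]; rfl
  have eV : ∫ ω, V ω ∂μ = ∑ i, v i * (μ (B i)).toReal := by
    simp_rw [hV]
    rw [integral_finsetSum _ fun i _ => (integrable_const (v i)).indicator (h₂ _ (hB i))]
    refine Finset.sum_congr rfl fun i _ => ?_
    rw [integral_indicator_const _ (h₂ _ (hB i)), smul_eq_mul, mul_comm]; rfl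
  have eUV : ∫ ω, U ω * V ω ∂μ = ∑ i, ∑ j, u i * v j * (μ (A i ∩ B j)).toReal := by
    have : ∀ ω, U ω * V ω = ∑ i, ∑ j, (A i ∩ B j).indicator (fun _ => u i * v j) ω := by
      intro ω
      rw [hU, hV, Finset.sum_mul_sum]
      refine Finset.sum_congr rfl fun i _ => Finset.sum_congr rfl fun j _ => ?_
      rw [Set.inter_indicator_mul]
    simp_rw [this]
    have hm := fun i j => (h₁ _ (hA i)).inter (h₂ _ (hB j))
    have hi : ∀ i j, Integrable ((A i ∩ B j).indicator (fun _ => u i * v j)) μ :=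
      fun i j => (integrable_const (u i * v j)).indicator (hm i j)
    rw [integral_finsetSum _ fun i _ => integrable_finsetSum _ fun j _ => hi i j]
    refine Finset.sum_congr rfl fun i _ => ?_
    rw [integral_finsetSum _ fun j _ => hi i j]
    refine Finset.sum_congr rfl fun j _ => ?_
    rw [integral_indicator_const _ (hm i j), smul_eq_mul, mul_comm]; rfl
  have key : ∑ i, ∑ j, |(μ (A i ∩ B j)).toReal - (μ (A i)).toReal * (μ (B j)).toReal|
      ≤ betaCoeff μ m₁ m₂ :=
    le_csSup ⟨2, betaCoeff_bdd _ _ μ h₁ h₂⟩ ⟨I, J, A, B, hA, hB, dA, dB, uA, uB, rfl⟩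
  calc _ = |∑ i, ∑ j, u i * v j *
        ((μ (A i ∩ B j)).toReal - (μ (A i)).toReal * (μ (B j)).toReal)| := by
        rw [eU, eV, eUV, Finset.sum_mul_sum, ← Finset.sum_sub_distrib]
        congr 1
        refine Finset.sum_congr rfl fun i _ => ?_
        rw [← Finset.sum_sub_distrib]
        exact Finset.sum_congr rfl fun j _ => by ring
    _ ≤ ∑ i, ∑ j, T ^ 2 *
        |(μ (A i ∩ B j)).toReal - (μ (A i)).toReal * (μ (B j)).toReal| := by
        refine (Finset.abs_sum_le_sum_abs _ _).trans (Finset.sum_le_sum fun i _ => ?_)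
        refine (Finset.abs_sum_le_sum_abs _ _).trans (Finset.sum_le_sum fun j _ => ?_)
        rw [abs_mul, abs_mul, sq]
        gcongr
        exacts [hu i, hv j]
    _ ≤ _ := by
        simp_rw [← Finset.mul_sum]
        gcongr

lemma simple_decomp {Ω : Type*} (m : MeasurableSpace Ω) (s : @SimpleFunc Ω m ℝ) :
    ∃ (I : ℕ) (A : Fin I → Set Ω) (u : Fin I → ℝ), (∀ i, MeasurableSet[m] (A i)) ∧
      Pairwise (Function.onFun Disjoint A) ∧ (⋃ i, A i) = Set.univ ∧
      (∀ i, ∃ ω, u i = s ω) ∧ ∀ ω, s ω = ∑ i, (A i).indicator (fun _ => u i) ω := by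
  classical
  let e := s.range.equivFin.symm
  have hmem : ∀ ω, s ω ∈ s.range := fun ω => s.mem_range_self ω
  refine ⟨s.range.card, fun i => s ⁻¹' {(e i : ℝ)}, fun i => (e i : ℝ),
    fun i => s.measurableSet_fiber _, ?_, ?_, ?_, ?_⟩
  · intro i j hij
    refine Set.disjoint_left.2 fun ω h1 h2 => hij ?_
    simp only [Set.mem_preimage, Set.mem_singleton_iff] at h1 h2
    exact e.injective (Subtype.ext (h1.symm.trans h2))
  · refine Set.eq_univ_of_forall fun ω => Set.mem_iUnion.2 ⟨e.symm ⟨s ω, hmem ω⟩, ?_⟩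
    simp
  · intro i
    obtain ⟨ω, h⟩ := SimpleFunc.mem_range.1 (e i).2
    exact ⟨ω, h.symm⟩
  · intro ω
    rw [Finset.sum_eq_single (e.symm ⟨s ω, hmem ω⟩)]
    · simp
    · intro j _ hj
      apply Set.indicator_of_notMem
      intro h
      apply hj
      simp only [Set.mem_preimage, Set.mem_singleton_iff] at h
      apply e.injective
      apply Subtype.ext
      simp [h]
    · simp

lemma cov_bdd {Ω : Type*} (m₁ m₂ : MeasurableSpace Ω) [mΩ : MeasurableSpace Ω]
    (μ : Measure Ω) [IsProbabilityMeasure μ] (h₁ : m₁ ≤ mΩ) (h₂ : m₂ ≤ mΩ)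
    (T : ℝ) (hT : 0 ≤ T) (U V : Ω → ℝ) (hU : Measurable[m₁] U) (hV : Measurable[m₂] V)
    (bU : ∀ ω, |U ω| ≤ T) (bV : ∀ ω, |V ω| ≤ T) :
    |∫ ω, U ω * V ω ∂μ - (∫ ω, U ω ∂μ) * ∫ ω, V ω ∂μ| ≤ T ^ 2 * betaCoeff μ m₁ m₂ := by
  have sU : StronglyMeasurable[m₁] U := hU.stronglyMeasurable
  have sV : StronglyMeasurable[m₂] V := hV.stronglyMeasurable
  have nU := fun n x => sU.norm_approxBounded_le hT n x
  have nV := fun n x => sV.norm_approxBounded_le hT n x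
  have tU := fun x => sU.tendsto_approxBounded_of_norm_le (c := T) (x := x) (bU x)
  have tV := fun x => sV.tendsto_approxBounded_of_norm_le (c := T) (x := x) (bV x)
  have mU : ∀ n, AEStronglyMeasurable (fun x => sU.approxBounded T n x) μ := fun n =>
    (((sU.approxBounded T n).stronglyMeasurable).mono h₁).aestronglyMeasurable
  have mV : ∀ n, AEStronglyMeasurable (fun x => sV.approxBounded T n x) μ := fun n =>
    (((sV.approxBounded T n).stronglyMeasurable).mono h₂).aestronglyMeasurable
  have l1 : Tendsto (fun n => ∫ x, sU.approxBounded T n x ∂μ) atTop (nhds (∫ x, U x ∂μ)) :=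
    tendsto_integral_of_dominated_convergence (fun _ => T) mU (integrable_const _)
      (fun n => ae_of_all _ (nU n)) (ae_of_all _ tU)
  have l2 : Tendsto (fun n => ∫ x, sV.approxBounded T n x ∂μ) atTop (nhds (∫ x, V x ∂μ)) :=
    tendsto_integral_of_dominated_convergence (fun _ => T) mV (integrable_const _)
      (fun n => ae_of_all _ (nV n)) (ae_of_all _ tV)
  have l3 : Tendsto (fun n => ∫ x, sU.approxBounded T n x * sV.approxBounded T n x ∂μ) atTop
      (nhds (∫ x, U x * V x ∂μ)) :=
    tendsto_integral_of_dominated_convergence (fun _ => T * T) (fun n => (mU n).mul (mV n))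
      (integrable_const _)
      (fun n => ae_of_all _ fun x => by
        rw [norm_mul]; exact mul_le_mul (nU n x) (nV n x) (norm_nonneg _) hT)
      (ae_of_all _ fun x => (tU x).mul (tV x))
  refine le_of_tendsto (l3.sub (l1.mul l2)).abs (Eventually.of_forall fun n => ?_)
  obtain ⟨I, A, u, hA, dA, uA, ru, eu⟩ := simple_decomp m₁ (sU.approxBounded T n)
  obtain ⟨J, B, v, hB, dB, uB, rv, ev⟩ := simple_decomp m₂ (sV.approxBounded T n)
  refine cov_partition m₁ m₂ μ h₁ h₂ I J A B hA hB dA dB uA uB u v T hT ?_ ?_ _ _ eu ev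
  · intro i
    obtain ⟨ω, h⟩ := ru i
    rw [h]; exact nU n ω
  · intro i
    obtain ⟨ω, h⟩ := rv i
    rw [h]; exact nV n ω


/-- Truncation at level `T`. -/
def clip (T x : ℝ) : ℝ := max (-T) (min x T)

lemma clip_abs (T x : ℝ) (hT : 0 ≤ T) : |clip T x| ≤ T := by
  rw [clip, abs_le]
  exact ⟨le_max_left _ _, max_le (by linarith) (min_le_right _ _)⟩

lemma clip_eq (T x : ℝ) (hx : |x| ≤ T) : clip T x = x := by
  rw [abs_le] at hx
  rw [clip, min_eq_left hx.2, max_eq_right hx.1]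

lemma clip_abs' (T x : ℝ) (hT : 0 ≤ T) : |clip T x| ≤ |x| := by
  by_cases h : |x| ≤ T
  · rw [clip_eq T x h]
  · exact (clip_abs T x hT).trans (not_le.1 h).le

lemma clip_lip (T x y : ℝ) : |clip T x - clip T y| ≤ |x - y| := by
  rw [clip, clip, max_comm, max_comm (-T) (min y T)]
  refine (abs_max_sub_max_le_abs _ _ _).trans ((abs_min_sub_min_le_max _ _ _ _).trans ?_)
  simp

lemma clip_meas (T : ℝ) : Measurable (clip T) := by
  unfold clip; fun_prop

lemma clip_mul (T x y P Q : ℝ) (hP : |P| ≤ T) (hy : |y| ≤ T) :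
    |P * Q - x * y| ≤ T * |P - x| + T * |Q - y| := by
  have : P * Q - x * y = P * (Q - y) + (P - x) * y := by ring
  rw [this]
  refine (abs_add_le _ _).trans ?_
  rw [abs_mul, abs_mul]
  nlinarith [abs_nonneg (Q - y), abs_nonneg (P - x), abs_nonneg P, abs_nonneg y]

lemma path_meas {Ω : Type*} [MeasurableSpace Ω] (Z : ℤ → Ω → ℝ) (k l t : ℤ) :
    @Measurable _ _ (sigmaIcc Z (k + t) (l + t)) (sigmaIcc (fun i (x : ℤ → ℝ) => x i) k l)
      (fun ω s => Z (s + t) ω) := by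
  rw [measurable_iff_comap_le]
  unfold sigmaIcc
  simp only [MeasurableSpace.comap_iSup, MeasurableSpace.comap_comp]
  refine iSup₂_le fun i hi => ?_
  exact le_iSup₂_of_le (f := fun i (_ : i ∈ Set.Icc (k + t) (l + t)) =>
    MeasurableSpace.comap (Z i) inferInstance) (i + t) ⟨by linarith [hi.1], by linarith [hi.2]⟩ le_rfl

lemma path_comap {Ω : Type*} [MeasurableSpace Ω] (Z : ℤ → Ω → ℝ) (k l : ℤ) :
    (sigmaIcc (fun i (x : ℤ → ℝ) => x i) k l).comap (fun ω s => Z s ω) = sigmaIcc Z k l := by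
  unfold sigmaIcc
  simp only [MeasurableSpace.comap_iSup, MeasurableSpace.comap_comp]
  rfl

lemma stat_int {Ω : Type*} [MeasurableSpace Ω] (μ : Measure Ω)
    (Z : ℤ → Ω → ℝ) (hZ : ∀ t, Measurable (Z t)) (hstat : Stationary μ Z)
    (F : (ℤ → ℝ) → ℝ) (hF : Measurable F) (t : ℤ) :
    ∫ ω, F (fun s => Z (s + t) ω) ∂μ = ∫ ω, F (fun s => Z s ω) ∂μ := by
  have h := hstat t
  have m1 : Measurable (fun ω => fun s : ℤ => Z (s + t) ω) := measurable_pi_lambda _ fun s => hZ _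
  have m2 : Measurable (fun ω => fun s : ℤ => Z s ω) := measurable_pi_lambda _ fun s => hZ _
  rw [← integral_map (f := F) m1.aemeasurable hF.aestronglyMeasurable, h,
    integral_map m2.aemeasurable hF.aestronglyMeasurable]

lemma bdd_integrable {Ω : Type*} [MeasurableSpace Ω] (μ : Measure Ω) [IsProbabilityMeasure μ]
    (T : ℝ) (U : Ω → ℝ) (hU : Measurable U) (bU : ∀ ω, |U ω| ≤ T) : Integrable U μ :=
  Integrable.of_bound hU.aestronglyMeasurable T (ae_of_all _ bU)

lemma cov_clip {Ω : Type*} [mΩ : MeasurableSpace Ω] (μ : Measure Ω) [IsProbabilityMeasure μ]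
    (Z : ℤ → Ω → ℝ) (hZ : ∀ t, Measurable (Z t)) (hstat : Stationary μ Z)
    (f : (ℤ → ℝ) → ℝ) (hf : Measurable f)
    (X : ℤ → Ω → ℝ) (hX : ∀ t ω, X t ω = f (fun k => Z (t + k) ω))
    (hXint : Integrable (X 0) μ) (a : ℝ) (m k : ℕ) (hk : 3 * m ≤ k)
    (happrox : ∫ ω, |X 0 ω - (μ[X 0 | sigmaIcc Z (-(m : ℤ)) (m : ℤ)]) ω| ∂μ ≤ a)
    (T : ℝ) (hT : 0 ≤ T) :
    |∫ ω, clip T (X 0 ω) * clip T (X k ω) ∂μ| ≤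
      3 * (T * a) + T ^ 2 * betaMix μ Z m + T * |∫ ω, clip T (X 0 ω) ∂μ| := by
  have hX' : ∀ t ω, X t ω = f (fun s => Z (s + t) ω) := by
    intro t ω; rw [hX]; congr 1; ext s; rw [add_comm]
  have mX : ∀ t, Measurable (X t) := fun t => by
    have : X t = fun ω => f (fun s => Z (s + t) ω) := funext (hX' t)
    rw [this]; exact hf.comp (measurable_pi_lambda _ fun s => hZ _)
  -- the approximating function
  obtain ⟨G, mG, hG⟩ : ∃ G : (ℤ → ℝ) → ℝ,
      Measurable[sigmaIcc (fun i (x : ℤ → ℝ) => x i) (-(m : ℤ)) m] G ∧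
      μ[X 0 | sigmaIcc Z (-(m : ℤ)) (m : ℤ)] = G ∘ (fun ω s => Z s ω) := by
    have h : Measurable[sigmaIcc Z (-(m : ℤ)) (m : ℤ)] (μ[X 0 | sigmaIcc Z (-(m : ℤ)) (m : ℤ)]) :=
      stronglyMeasurable_condExp.measurable
    rw [← path_comap] at h
    have := @Measurable.exists_eq_measurable_comp _ _ _
      (sigmaIcc (fun i (x : ℤ → ℝ) => x i) (-(m : ℤ)) m) _ _ _ _ _ h
    rwa [path_comap] at this
  have mG' : Measurable G := mG.mono (sigmaIcc_le _ (fun t => measurable_pi_apply t) _ _) le_rfl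
  have iG : Integrable (fun ω => G (fun s => Z s ω)) μ := by
    have : Integrable (μ[X 0 | sigmaIcc Z (-(m : ℤ)) (m : ℤ)]) μ := integrable_condExp
    rwa [hG] at this
  let Y : ℤ → Ω → ℝ := fun t ω => G (fun s => Z (s + t) ω)
  have mY : ∀ t, Measurable (Y t) := fun t => mG'.comp (measurable_pi_lambda _ fun s => hZ _)
  have mY' : ∀ t, Measurable[sigmaIcc Z (-(m : ℤ) + t) (m + t)] (Y t) := fun t =>
    @Measurable.comp _ _ _ (sigmaIcc Z (-(m : ℤ) + t) (m + t))
      (sigmaIcc (fun i (x : ℤ → ℝ) => x i) (-(m : ℤ)) m) _ _ _ mG (path_meas Z _ _ t)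
  let P : ℤ → Ω → ℝ := fun t ω => clip T (X t ω)
  let U : ℤ → Ω → ℝ := fun t ω => clip T (Y t ω)
  have mP : ∀ t, Measurable (P t) := fun t => (clip_meas T).comp (mX t)
  have mU : ∀ t, Measurable (U t) := fun t => (clip_meas T).comp (mY t)
  have bP : ∀ t ω, |P t ω| ≤ T := fun t ω => clip_abs _ _ hT
  have bU : ∀ t ω, |U t ω| ≤ T := fun t ω => clip_abs _ _ hT
  have iP : ∀ t, Integrable (P t) μ := fun t => bdd_integrable μ T _ (mP t) (bP t)
  have iU : ∀ t, Integrable (U t) μ := fun t => bdd_integrable μ T _ (mU t) (bU t)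
  have iPU : ∀ t, Integrable (fun ω => |P t ω - U t ω|) μ := fun t => ((iP t).sub (iU t)).abs
  have dPU : ∀ t, ∫ ω, |P t ω - U t ω| ∂μ ≤ a := by
    intro t
    have e1 : ∫ ω, |P t ω - U t ω| ∂μ = ∫ ω, |P 0 ω - U 0 ω| ∂μ := by
      have h1 := stat_int μ Z hZ hstat (fun x => |clip T (f x) - clip T (G x)|)
        (((clip_meas T).comp hf).sub ((clip_meas T).comp mG')).abs
      have h2 := (h1 t).trans (h1 0).symm
      simpa only [P, U, Y, hX'] using h2
    rw [e1]
    refine le_trans ?_ happrox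
    rw [hG]
    refine integral_mono (iPU 0) (hXint.sub iG).abs fun ω => ?_
    have := clip_lip T (X 0 ω) (Y 0 ω)
    simpa [P, U, Y] using this
  -- shift
  have eP : ∀ t, ∫ ω, P t ω ∂μ = ∫ ω, P 0 ω ∂μ := by
    intro t
    have h1 := stat_int μ Z hZ hstat (fun x => clip T (f x)) ((clip_meas T).comp hf)
    have h2 := (h1 t).trans (h1 0).symm
    simpa only [P, hX'] using h2
  set s : ℤ := m + 1 with hs
  have ePP : ∫ ω, P 0 ω * P k ω ∂μ = ∫ ω, P s ω * P (k + s) ω ∂μ := by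
    have h1 := stat_int μ Z hZ hstat
      (fun x => clip T (f x) * clip T (f (fun j => x (j + k))))
      (((clip_meas T).comp hf).mul ((clip_meas T).comp
        (hf.comp (measurable_pi_lambda _ fun j => measurable_pi_apply _))))
    have h2 := (h1 0).trans (h1 s).symm
    simpa only [P, hX', add_zero, add_assoc] using h2
  have cov : |∫ ω, U s ω * U (k + s) ω ∂μ - (∫ ω, U s ω ∂μ) * ∫ ω, U (k + s) ω ∂μ|
      ≤ T ^ 2 * betaMix μ Z m := by
    have m1 : Measurable[sigmaIcc Z 1 ((2 * m + 1 : ℕ) : ℤ)] (U s) := by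
      have := mY' s
      have e1 : -(m : ℤ) + s = 1 := by rw [hs]; ring
      have e2 : (m : ℤ) + s = ((2 * m + 1 : ℕ) : ℤ) := by rw [hs]; push_cast; ring
      rw [e1, e2] at this
      exact (clip_meas T).comp this
    have m2 : Measurable[sigmaIci Z (((2 * m + 1 : ℕ) : ℤ) + (m : ℕ))] (U (k + s)) := by
      have := mY' (k + s)
      have hle : sigmaIcc Z (-(m : ℤ) + (k + s)) (m + (k + s)) ≤
          sigmaIci Z (((2 * m + 1 : ℕ) : ℤ) + (m : ℕ)) := by
        refine iSup₂_le fun i hi => ?_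
        refine le_iSup₂_of_le (f := fun i (_ : i ∈ Set.Ici (((2 * m + 1 : ℕ) : ℤ) + (m : ℕ))) =>
          MeasurableSpace.comap (Z i) inferInstance) i ?_ le_rfl
        have := hi.1
        simp only [Set.mem_Ici]
        push_cast
        omega
      exact (clip_meas T).comp (this.mono hle le_rfl)
    refine (cov_bdd _ _ μ (sigmaIcc_le Z hZ _ _) (sigmaIci_le Z hZ _) T hT _ _ m1 m2
      (bU s) (bU _)).trans ?_
    gcongr
    exact betaCoeff_le_betaMix μ Z hZ (2 * m + 1) m (by omega)
  have iPP : Integrable (fun ω => P s ω * P (k + s) ω) μ :=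
    bdd_integrable μ (T * T) _ ((mP _).mul (mP _)) fun ω => by
      rw [abs_mul]; exact mul_le_mul (bP _ _) (bP _ _) (abs_nonneg _) hT
  have iUU : Integrable (fun ω => U s ω * U (k + s) ω) μ :=
    bdd_integrable μ (T * T) _ ((mU _).mul (mU _)) fun ω => by
      rw [abs_mul]; exact mul_le_mul (bU _ _) (bU _ _) (abs_nonneg _) hT
  have d1 : |∫ ω, P s ω * P (k + s) ω ∂μ - ∫ ω, U s ω * U (k + s) ω ∂μ| ≤ 2 * (T * a) := by
    rw [← integral_sub iPP iUU]
    calc _ ≤ ∫ ω, |P s ω * P (k + s) ω - U s ω * U (k + s) ω| ∂μ := abs_integral_le_integral_abs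
      _ ≤ ∫ ω, (T * |P s ω - U s ω| + T * |P (k + s) ω - U (k + s) ω|) ∂μ :=
          integral_mono (iPP.sub iUU).abs (((iPU _).const_mul T).add ((iPU _).const_mul T))
            fun ω => clip_mul T _ _ _ _ (bP _ _) (bU _ _)
      _ = T * ∫ ω, |P s ω - U s ω| ∂μ + T * ∫ ω, |P (k + s) ω - U (k + s) ω| ∂μ := by
          rw [integral_add ((iPU _).const_mul T) ((iPU _).const_mul T), integral_const_mul,
            integral_const_mul]
      _ ≤ _ := by
          have h1 := mul_le_mul_of_nonneg_left (dPU s) hT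
          have h2 := mul_le_mul_of_nonneg_left (dPU (k + s)) hT
          linarith
  have d2 : |∫ ω, P s ω ∂μ - ∫ ω, U s ω ∂μ| ≤ a := by
    rw [← integral_sub (iP s) (iU s)]
    exact abs_integral_le_integral_abs.trans (dPU s)
  have d3 : |∫ ω, U (k + s) ω ∂μ| ≤ T := by
    have := norm_integral_le_of_norm_le_const (μ := μ) (f := U (k + s)) (C := T)
      (ae_of_all _ (bU (k + s)))
    simpa using this
  have d4 : |∫ ω, U s ω ∂μ| ≤ |∫ ω, P 0 ω ∂μ| + a := by
    rw [← eP s]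
    have := abs_sub_abs_le_abs_sub (∫ ω, U s ω ∂μ) (∫ ω, P s ω ∂μ)
    rw [abs_sub_comm] at this
    linarith
  have d5 : |(∫ ω, U s ω ∂μ) * ∫ ω, U (k + s) ω ∂μ| ≤ (|∫ ω, P 0 ω ∂μ| + a) * T := by
    rw [abs_mul]
    exact mul_le_mul d4 d3 (abs_nonneg _) ((abs_nonneg _).trans d4)
  change |∫ ω, P 0 ω * P k ω ∂μ| ≤ 3 * (T * a) + T ^ 2 * betaMix μ Z m + T * |∫ ω, P 0 ω ∂μ|
  rw [ePP]
  rw [abs_le] at *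
  constructor <;> nlinarith


lemma tail_sq (T x δ : ℝ) (hT : 0 < T) (hδ : 0 < δ) (hx : T < |x|) :
    |x| * |x| ≤ |x| ^ (2 + δ) * T ^ (-δ) := by
  have hx0 : 0 < |x| := hT.trans hx
  rw [Real.rpow_add hx0, Real.rpow_neg hT.le, Real.rpow_two, mul_assoc, ← sq]
  refine le_mul_of_one_le_right (by positivity) ?_
  rw [← div_eq_mul_inv, one_le_div (by positivity)]
  exact Real.rpow_le_rpow hT.le hx.le hδ.le

lemma tail_one (T x δ : ℝ) (hT : 0 < T) (hδ : 0 < δ) :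
    T * |x - clip T x| ≤ 2 * (|x| ^ (2 + δ) * T ^ (-δ)) := by
  by_cases h : |x| ≤ T
  · rw [clip_eq T x h]; simp; positivity
  · have h' := not_le.1 h
    have h1 := tail_sq T x δ hT hδ h'
    have h2 : |x - clip T x| ≤ 2 * |x| := by
      refine (abs_sub _ _).trans ?_
      linarith [clip_abs' T x hT.le]
    nlinarith [abs_nonneg x, abs_nonneg (x - clip T x)]

lemma tail_two (T x y δ : ℝ) (hT : 0 < T) (hδ : 0 < δ) :
    |x * y - clip T x * clip T y| ≤
      2 * (|x| ^ (2 + δ) * T ^ (-δ)) + 2 * (|y| ^ (2 + δ) * T ^ (-δ)) := by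
  have px : 0 ≤ |x| ^ (2 + δ) * T ^ (-δ) := by positivity
  have py : 0 ≤ |y| ^ (2 + δ) * T ^ (-δ) := by positivity
  by_cases h : |x| ≤ T ∧ |y| ≤ T
  · rw [clip_eq T x h.1, clip_eq T y h.2, sub_self, abs_zero]; positivity
  · have h2 : |x * y - clip T x * clip T y| ≤ 2 * (|x| * |y|) := by
      refine (abs_sub _ _).trans ?_
      rw [abs_mul, abs_mul]
      nlinarith [clip_abs' T x hT.le, clip_abs' T y hT.le, abs_nonneg x, abs_nonneg y,
        abs_nonneg (clip T x), abs_nonneg (clip T y)]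
    rcases le_total |x| |y| with hxy | hxy
    · have hy : T < |y| := by
        by_contra hc
        exact h ⟨hxy.trans (not_lt.1 hc), not_lt.1 hc⟩
      have := tail_sq T y δ hT hδ hy
      nlinarith [abs_nonneg x, abs_nonneg y]
    · have hx : T < |x| := by
        by_contra hc
        exact h ⟨not_lt.1 hc, hxy.trans (not_lt.1 hc)⟩
      have := tail_sq T x δ hT hδ hx
      nlinarith [abs_nonneg x, abs_nonneg y]

lemma moment_bound {Ω : Type*} [MeasurableSpace Ω] (μ : Measure Ω) [IsProbabilityMeasure μ]
    (x y : Ω → ℝ) (mx : Measurable x) (my : Measurable y) (δ : ℝ) (hδ : 0 < δ)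
    (ix : Integrable (fun ω => |x ω| ^ (2 + δ)) μ) (iy : Integrable (fun ω => |y ω| ^ (2 + δ)) μ)
    (hxy : ∫ ω, |y ω| ^ (2 + δ) ∂μ = ∫ ω, |x ω| ^ (2 + δ) ∂μ)
    (ix1 : Integrable x μ) (ixy : Integrable (fun ω => x ω * y ω) μ) (hmean : ∫ ω, x ω ∂μ = 0)
    (T c : ℝ) (hT : 0 < T)
    (h : |∫ ω, clip T (x ω) * clip T (y ω) ∂μ| ≤ c + T * |∫ ω, clip T (x ω) ∂μ|) :
    |∫ ω, x ω * y ω ∂μ| ≤ c + 6 * (∫ ω, |x ω| ^ (2 + δ) ∂μ) * T ^ (-δ) := by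
  set M := ∫ ω, |x ω| ^ (2 + δ) ∂μ
  have icx : Integrable (fun ω => clip T (x ω)) μ :=
    bdd_integrable μ T _ ((clip_meas T).comp mx) fun ω => clip_abs _ _ hT.le
  have icc : Integrable (fun ω => clip T (x ω) * clip T (y ω)) μ :=
    bdd_integrable μ (T * T) _ (((clip_meas T).comp mx).mul ((clip_meas T).comp my)) fun ω => by
      rw [abs_mul]
      exact mul_le_mul (clip_abs _ _ hT.le) (clip_abs _ _ hT.le) (abs_nonneg _) hT.le
  have e1 : T * |∫ ω, clip T (x ω) ∂μ| ≤ 2 * (M * T ^ (-δ)) := by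
    have : |∫ ω, clip T (x ω) ∂μ| = |∫ ω, (x ω - clip T (x ω)) ∂μ| := by
      rw [integral_sub ix1 icx, hmean, zero_sub, abs_neg]
    rw [this]
    calc _ ≤ T * ∫ ω, |x ω - clip T (x ω)| ∂μ := by
          gcongr; exact abs_integral_le_integral_abs
      _ = ∫ ω, T * |x ω - clip T (x ω)| ∂μ := (integral_const_mul _ _).symm
      _ ≤ ∫ ω, 2 * (|x ω| ^ (2 + δ) * T ^ (-δ)) ∂μ :=
          integral_mono ((ix1.sub icx).abs.const_mul T) ((ix.mul_const _).const_mul 2)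
            fun ω => tail_one T (x ω) δ hT hδ
      _ = _ := by rw [integral_const_mul, integral_mul_const]
  have e2 : |∫ ω, x ω * y ω ∂μ - ∫ ω, clip T (x ω) * clip T (y ω) ∂μ| ≤ 4 * (M * T ^ (-δ)) := by
    rw [← integral_sub ixy icc]
    calc _ ≤ ∫ ω, |x ω * y ω - clip T (x ω) * clip T (y ω)| ∂μ := abs_integral_le_integral_abs
      _ ≤ ∫ ω, (2 * (|x ω| ^ (2 + δ) * T ^ (-δ)) + 2 * (|y ω| ^ (2 + δ) * T ^ (-δ))) ∂μ :=
          integral_mono (ixy.sub icc).abs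
            (((ix.mul_const _).const_mul 2).add ((iy.mul_const _).const_mul 2))
            fun ω => tail_two T (x ω) (y ω) δ hT hδ
      _ = _ := by
          rw [integral_add ((ix.mul_const _).const_mul 2) ((iy.mul_const _).const_mul 2),
            integral_const_mul, integral_mul_const, integral_const_mul, integral_mul_const, hxy]
          ring
  have := abs_sub_abs_le_abs_sub (∫ ω, x ω * y ω ∂μ) (∫ ω, clip T (x ω) * clip T (y ω) ∂μ)
  linarith

lemma summable_div_three (b : ℕ → ℝ) (hb : Summable b) (hn : ∀ k, 0 ≤ b k) :
    Summable (fun k : ℕ => b (k / 3)) := by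
  have h : Summable (fun p : ℕ × Fin 3 => b p.1 * 1) :=
    Summable.mul_of_nonneg (g := fun _ : Fin 3 => (1 : ℝ)) hb (Summable.of_finite) hn
      (fun _ => zero_le_one)
  have := (Nat.divModEquiv 3).summable_iff.2 h
  simpa [Function.comp_def, Nat.divModEquiv] using this

/-- choice of truncation level -/
lemma level_bound (δ a b e : ℝ) (hδ : 0 < δ) (ha : 0 ≤ a) (hb : 0 ≤ b) (he : 0 < e) :
    ∃ T : ℝ, 0 < T ∧ T * a ≤ a ^ (δ / (1 + δ)) + b ^ (δ / (2 + δ)) + e ^ δ ∧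
      T ^ 2 * b ≤ a ^ (δ / (1 + δ)) + b ^ (δ / (2 + δ)) + e ^ δ ∧
      T ^ (-δ) ≤ a ^ (δ / (1 + δ)) + b ^ (δ / (2 + δ)) + e ^ δ := by
  set u := a ^ (1 / (1 + δ)) with hu
  set v := b ^ (1 / (2 + δ)) with hv
  have u0 : 0 ≤ u := by positivity
  have v0 : 0 ≤ v := by positivity
  have eu : u ^ δ = a ^ (δ / (1 + δ)) := by
    rw [hu, ← Real.rpow_mul ha]; congr 1; ring
  have ev : v ^ δ = b ^ (δ / (2 + δ)) := by
    rw [hv, ← Real.rpow_mul hb]; congr 1; ring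
  have ea : a = u ^ (1 + δ) := by
    rw [hu, ← Real.rpow_mul ha, one_div_mul_cancel (by positivity), Real.rpow_one]
  have eb : b = v ^ (2 + δ) := by
    rw [hv, ← Real.rpow_mul hb, one_div_mul_cancel (by positivity), Real.rpow_one]
  set w := max (max u v) e with hw
  have w0 : 0 < w := he.trans_le (le_max_right _ _)
  have uw : u ≤ w := (le_max_left _ _).trans (le_max_left _ _)
  have vw : v ≤ w := (le_max_right _ _).trans (le_max_left _ _)
  have key : w ^ δ ≤ a ^ (δ / (1 + δ)) + b ^ (δ / (2 + δ)) + e ^ δ := by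
    rw [← eu, ← ev]
    have p1 : 0 ≤ u ^ δ := by positivity
    have p2 : 0 ≤ v ^ δ := by positivity
    have p3 : 0 ≤ e ^ δ := by positivity
    rcases max_choice (max u v) e with h | h
    · rcases max_choice u v with h' | h'
      · rw [hw, h, h']; linarith
      · rw [hw, h, h']; linarith
    · rw [hw, h]; linarith
  refine ⟨w⁻¹, by positivity, le_trans ?_ key, le_trans ?_ key, le_trans ?_ key⟩
  · have h1 : a ≤ w ^ (1 + δ) := by
      rw [ea]; exact Real.rpow_le_rpow u0 uw (by positivity)
    rw [Real.rpow_add w0, Real.rpow_one] at h1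
    rw [inv_mul_le_iff₀ w0]; exact h1
  · have h1 : b ≤ w ^ (2 + δ) := by
      rw [eb]; exact Real.rpow_le_rpow v0 vw (by positivity)
    rw [Real.rpow_add w0, Real.rpow_two] at h1
    rw [inv_pow, inv_mul_le_iff₀ (by positivity)]; exact h1
  · rw [Real.rpow_neg (by positivity), Real.inv_rpow w0.le, inv_inv]

lemma variance_limit {Ω : Type*} [MeasurableSpace Ω] (μ : Measure Ω) [IsProbabilityMeasure μ]
    (X : ℤ → Ω → ℝ) (h2 : ∀ t, MemLp (X t) 2 μ)
    (hst : ∀ s t : ℤ, ∫ ω, X t ω * X (s + t) ω ∂μ = ∫ ω, X 0 ω * X s ω ∂μ)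
    (hs : Summable (fun k : ℕ => |∫ ω, X 0 ω * X ((k : ℤ) + 1) ω ∂μ|)) :
    Tendsto (fun n : ℕ =>
        (1 / (n : ℝ)) * ∫ ω, (∑ t ∈ Finset.Icc 1 n, X (t : ℤ) ω) ^ 2 ∂μ) atTop
      (nhds (∫ ω, (X 0 ω) ^ 2 ∂μ
        + 2 * ∑' k : ℕ, ∫ ω, X 0 ω * X ((k : ℤ) + 1) ω ∂μ)) := by
  set γ : ℕ → ℝ := fun k => ∫ ω, X 0 ω * X ((k : ℤ) + 1) ω ∂μ with hγ
  have iXX : ∀ s t, Integrable (fun ω => X s ω * X t ω) μ := fun s t => (h2 s).integrable_mul (h2 t)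
  let S : ℕ → Ω → ℝ := fun n ω => ∑ t ∈ Finset.Icc 1 n, X (t : ℤ) ω
  have hS2 : ∀ n, MemLp (S n) 2 μ := fun n => memLp_finsetSum _ fun t _ => h2 t
  have step : ∀ n, ∫ ω, (S (n + 1) ω) ^ 2 ∂μ =
      ∫ ω, (S n ω) ^ 2 ∂μ + (∫ ω, (X 0 ω) ^ 2 ∂μ + 2 * ∑ k ∈ Finset.range n, γ k) := by
    intro n
    have e : ∀ ω, (S (n + 1) ω) ^ 2 = (S n ω) ^ 2 + (X ((n : ℤ) + 1) ω * X ((n : ℤ) + 1) ω +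
        2 * ∑ t ∈ Finset.Icc 1 n, X t ω * X ((n : ℤ) + 1) ω) := by
      intro ω
      have : S (n + 1) ω = S n ω + X ((n : ℤ) + 1) ω := by
        simp only [S]
        rw [Finset.sum_Icc_succ_top (by omega)]
        push_cast; rfl
      rw [this, ← Finset.sum_mul]
      simp only [S]
      ring
    simp_rw [e]
    have i3 : Integrable (fun ω => ∑ t ∈ Finset.Icc 1 n, X t ω * X ((n : ℤ) + 1) ω) μ :=
      integrable_finsetSum _ fun t _ => iXX _ _
    have i4 : Integrable (fun ω => X ((n : ℤ) + 1) ω * X ((n : ℤ) + 1) ω +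
        2 * ∑ t ∈ Finset.Icc 1 n, X t ω * X ((n : ℤ) + 1) ω) μ :=
      (iXX _ _).add (i3.const_mul 2)
    rw [integral_add (hS2 n).integrable_sq i4,
      integral_add (iXX _ _) (i3.const_mul 2), integral_const_mul,
      integral_finsetSum _ fun t _ => iXX _ _]
    congr 2
    · have := hst 0 ((n : ℤ) + 1)
      rw [zero_add] at this
      rw [this]; simp_rw [sq]
    · congr 1
      have hr : ∑ k ∈ Finset.range n, γ k = ∑ k ∈ Finset.range n, γ (n - 1 - k) :=
        (Finset.sum_range_reflect γ n).symm
      rw [hr, Finset.range_eq_Ico, ← Finset.Ico_succ_right_eq_Icc]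
      rw [Finset.sum_Ico_eq_sum_range, ← Finset.range_eq_Ico]
      refine Finset.sum_congr (by simp) fun k hk => ?_
      have hk' : k < n := by simpa using hk
      have := hst (((n - 1 - k : ℕ) : ℤ) + 1) ((1 + k : ℕ) : ℤ)
      have e2 : (((n - 1 - k : ℕ) : ℤ) + 1) + ((1 + k : ℕ) : ℤ) = (n : ℤ) + 1 := by omega
      rw [e2] at this
      exact this
  have sumf : ∀ n, ∫ ω, (S n ω) ^ 2 ∂μ =
      ∑ i ∈ Finset.range n, (∫ ω, (X 0 ω) ^ 2 ∂μ + 2 * ∑ k ∈ Finset.range i, γ k) := by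
    intro n
    induction n with
    | zero => simp [S]
    | succ n ih => rw [step, ih, Finset.sum_range_succ]
  have hγs : Summable γ := summable_abs_iff.1 hs
  have := ((hγs.hasSum.tendsto_sum_nat.const_mul 2).const_add (∫ ω, (X 0 ω) ^ 2 ∂μ)).cesaro
  refine this.congr fun n => ?_
  change _ = 1 / (n : ℝ) * ∫ ω, (S n ω) ^ 2 ∂μ
  rw [sumf, one_div]

/-- variance of partial sums: For a centered 1-approximating functional of
a stationary absolutely regular process, under (i) boundedness and `Σ_{k≥d}(a_k+β_k) < ∞`, or
(ii) `E|X_0|^{2+δ} < ∞` and `Σ_{k≥d}(a_k^{δ/(1+δ)}+β_k^{δ/(2+δ)}) < ∞`, the series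
`Σ_{k≥1} E(X_0 X_k)` converges absolutely and
`(1/n) E S_n² → E X_0² + 2 Σ_{k≥1} E(X_0 X_k)`. -/
theorem stmt_13 {Ω : Type*} [MeasurableSpace Ω] (μ : Measure Ω) [IsProbabilityMeasure μ]
    (Z : ℤ → Ω → ℝ) (hZmeas : ∀ t, Measurable (Z t)) (hstat : Stationary μ Z)
    (β : ℕ → ℝ) (hβ : ∀ k, β k = betaMix μ Z k) (hreg : Tendsto β atTop (nhds 0))
    (f : (ℤ → ℝ) → ℝ) (hf : Measurable f)
    (X : ℤ → Ω → ℝ) (hX : ∀ t ω, X t ω = f (fun k => Z (t + k) ω))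
    (a : ℕ → ℝ) (ha0 : Tendsto a atTop (nhds 0)) (hann : ∀ k, 0 ≤ a k)
    (happrox : ∀ k : ℕ,
      ∫ ω, |X 0 ω - (μ[X 0 | sigmaIcc Z (-(k : ℤ)) (k : ℤ)]) ω| ∂μ ≤ a k)
    (hXint : Integrable (X 0) μ) (hmean : ∫ ω, X 0 ω ∂μ = 0)
    (d : ℕ)
    (hcond :
      ((∃ Mb : ℝ, ∀ᵐ ω ∂μ, |X 0 ω| ≤ Mb)
          ∧ Summable (fun k : ℕ => a (d + k) + β (d + k)))
      ∨ (∃ δ : ℝ, 0 < δ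
          ∧ Integrable (fun ω => |X 0 ω| ^ ((2 : ℝ) + δ)) μ
          ∧ Summable (fun k : ℕ =>
              a (d + k) ^ (δ / (1 + δ)) + β (d + k) ^ (δ / (2 + δ))))) :
    Summable (fun k : ℕ => |∫ ω, X 0 ω * X ((k : ℤ) + 1) ω ∂μ|)
    ∧ Tendsto (fun n : ℕ =>
        (1 / (n : ℝ)) * ∫ ω, (∑ t ∈ Finset.Icc 1 n, X (t : ℤ) ω) ^ 2 ∂μ) atTop
      (nhds (∫ ω, (X 0 ω) ^ 2 ∂μ
        + 2 * ∑' k : ℕ, ∫ ω, X 0 ω * X ((k : ℤ) + 1) ω ∂μ)) := by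
  have hX' : ∀ t ω, X t ω = f (fun s => Z (s + t) ω) := by
    intro t ω; rw [hX]; congr 1; ext s; rw [add_comm]
  have mX : ∀ t, Measurable (X t) := fun t => by
    have : X t = fun ω => f (fun s => Z (s + t) ω) := funext (hX' t)
    rw [this]; exact hf.comp (measurable_pi_lambda _ fun s => hZmeas _)
  have hβ0 : ∀ k, 0 ≤ β k := fun k => by rw [hβ]; exact betaMix_nonneg μ Z k
  have hid : ∀ t, IdentDistrib (X t) (X 0) μ μ := by
    intro t
    refine ⟨(mX t).aemeasurable, (mX 0).aemeasurable, ?_⟩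
    have e : ∀ t, Measure.map (X t) μ =
        Measure.map f (Measure.map (fun ω => fun s : ℤ => Z (s + t) ω) μ) := by
      intro t
      rw [Measure.map_map hf (measurable_pi_lambda _ fun s => hZmeas _)]
      congr 1
      exact funext (hX' t)
    rw [e t, e 0, hstat t, hstat 0]
  have hst : ∀ s t : ℤ, ∫ ω, X t ω * X (s + t) ω ∂μ = ∫ ω, X 0 ω * X s ω ∂μ := by
    intro s t
    have h1 := stat_int μ Z hZmeas hstat (fun x => f x * f (fun j => x (j + s)))
      (hf.mul (hf.comp (measurable_pi_lambda _ fun j => measurable_pi_apply _)))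
    have h2 := (h1 t).trans (h1 0).symm
    simpa only [hX', add_zero, add_assoc] using h2
  have clipb := fun (k : ℕ) (T : ℝ) (hT : 0 ≤ T) =>
    cov_clip μ Z hZmeas hstat f hf X hX hXint (a (k / 3)) (k / 3) k (by omega) (happrox (k / 3)) T hT
  simp only [← hβ] at clipb
  have main : MemLp (X 0) 2 μ ∧ ∃ b : ℕ → ℝ, Summable b ∧ (∀ k, 0 ≤ b k) ∧
      ∀ k : ℕ, |∫ ω, X 0 ω * X k ω ∂μ| ≤ b (k / 3) := by
    rcases hcond with ⟨⟨Mb, hMb⟩, hsum⟩ | ⟨δ, hδ, hint, hsum⟩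
    · refine ⟨MemLp.of_bound (mX 0).aestronglyMeasurable Mb hMb, ?_⟩
      set T := max Mb 0 with hTdef
      have hT : 0 ≤ T := le_max_right _ _
      have hae : ∀ t, ∀ᵐ ω ∂μ, clip T (X t ω) = X t ω := by
        intro t
        have : ∀ᵐ ω ∂μ, |X t ω| ≤ Mb :=
          (hid t).symm.ae_snd (p := fun x => |x| ≤ Mb)
            (measurableSet_le measurable_norm measurable_const) hMb
        filter_upwards [this] with ω h
        exact clip_eq _ _ (h.trans (le_max_left _ _))
      have hs0 : Summable (fun k => a k + β k) := by
        have : Summable (fun k => a (k + d) + β (k + d)) := by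
          simpa only [add_comm d] using hsum
        exact (summable_nat_add_iff (f := fun k => a k + β k) d).1 this
      have sa : Summable a :=
        hs0.of_nonneg_of_le hann fun k => le_add_of_nonneg_right (hβ0 k)
      have sb : Summable β :=
        hs0.of_nonneg_of_le hβ0 fun k => le_add_of_nonneg_left (hann k)
      refine ⟨fun k => 3 * (T * a k) + T ^ 2 * β k,
        ((sa.mul_left T).mul_left 3).add (sb.mul_left _), fun k => ?_, fun k => ?_⟩
      · have := hann k
        have := hβ0 k
        positivity
      · have h := clipb k T hT
        have e1 : ∫ ω, clip T (X 0 ω) * clip T (X k ω) ∂μ = ∫ ω, X 0 ω * X k ω ∂μ := by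
          refine integral_congr_ae ?_
          filter_upwards [hae 0, hae k] with ω h1 h2
          rw [h1, h2]
        have e2 : ∫ ω, clip T (X 0 ω) ∂μ = 0 := by
          rw [← hmean]
          exact integral_congr_ae (hae 0)
        rw [e1, e2] at h
        simpa using h
    · have hX2 : MemLp (X 0) 2 μ := by
        rw [memLp_two_iff_integrable_sq (mX 0).aestronglyMeasurable]
        refine Integrable.mono' (hint.add (integrable_const 1))
          ((mX 0).pow_const 2).aestronglyMeasurable (ae_of_all _ fun ω => ?_)
        rw [Real.norm_eq_abs, abs_pow, sq]
        change |X 0 ω| * |X 0 ω| ≤ |X 0 ω| ^ (2 + δ) + 1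
        have p : 0 ≤ |X 0 ω| ^ (2 + δ) := by positivity
        rcases le_or_gt |X 0 ω| 1 with h | h
        · nlinarith [abs_nonneg (X 0 ω)]
        · have := tail_sq 1 (X 0 ω) δ one_pos hδ h
          rw [Real.one_rpow, mul_one] at this
          linarith
      have hX2' : ∀ t, MemLp (X t) 2 μ := fun t => (hid t).memLp_iff.2 hX2
      have hpow : Measurable (fun x : ℝ => |x| ^ (2 + δ)) := by fun_prop
      have hidp := fun t => (hid t).comp hpow
      refine ⟨hX2, ?_⟩
      have hs0 : Summable (fun k => a k ^ (δ / (1 + δ)) + β k ^ (δ / (2 + δ))) := by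
        refine (summable_nat_add_iff
          (f := fun k => a k ^ (δ / (1 + δ)) + β k ^ (δ / (2 + δ))) d).1 ?_
        simpa only [add_comm d] using hsum
      have hg : Summable (fun k : ℕ => ((1 / 2 : ℝ) ^ k) ^ δ) := by
        have : ∀ k : ℕ, ((1 / 2 : ℝ) ^ k) ^ δ = ((1 / 2 : ℝ) ^ δ) ^ k := by
          intro k
          rw [← Real.rpow_natCast, ← Real.rpow_natCast, ← Real.rpow_mul (by norm_num),
            ← Real.rpow_mul (by norm_num), mul_comm]
        simp_rw [this]
        exact summable_geometric_of_lt_one (by positivity)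
          (Real.rpow_lt_one (by norm_num) (by norm_num) hδ)
      set M := ∫ ω, |X 0 ω| ^ (2 + δ) ∂μ with hM
      have hM0 : 0 ≤ M := integral_nonneg fun ω => by positivity
      refine ⟨fun k => (4 + 6 * M) *
        (a k ^ (δ / (1 + δ)) + β k ^ (δ / (2 + δ)) + ((1 / 2 : ℝ) ^ k) ^ δ),
        (hs0.add hg).mul_left _, fun k => ?_, fun k => ?_⟩
      · have := Real.rpow_nonneg (hann k) (δ / (1 + δ))
        have := Real.rpow_nonneg (hβ0 k) (δ / (2 + δ))
        positivity
      · obtain ⟨T, hT, t1, t2, t3⟩ := level_bound δ (a (k / 3)) (β (k / 3)) ((1 / 2 : ℝ) ^ (k / 3))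
          hδ (hann _) (hβ0 _) (by positivity)
        have := moment_bound μ (X 0) (X k) (mX 0) (mX k) δ hδ hint ((hidp k).integrable_iff.2 hint)
          (hidp k).integral_eq hXint (hX2.integrable_mul (hX2' k)) hmean T _ hT (clipb k T hT.le)
        rw [← hM] at this
        refine this.trans ?_
        have t4 := mul_le_mul_of_nonneg_left t3 (by positivity : 0 ≤ 6 * M)
        linarith
  obtain ⟨hX2, b, sb, b0, hb⟩ := main
  have hsum : Summable (fun k : ℕ => |∫ ω, X 0 ω * X ((k : ℤ) + 1) ω ∂μ|) := by
    have h1 : Summable (fun k : ℕ => |∫ ω, X 0 ω * X (k : ℤ) ω ∂μ|) :=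
      (summable_div_three b sb b0).of_nonneg_of_le (fun k => abs_nonneg _) hb
    have h2 := (summable_nat_add_iff (f := fun k : ℕ => |∫ ω, X 0 ω * X (k : ℤ) ω ∂μ|) 1).2 h1
    simpa only [Nat.cast_add, Nat.cast_one] using h2
  exact ⟨hsum, variance_limit μ X (fun t => (hid t).memLp_iff.2 hX2) hst hsum⟩
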